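/- Let p be a prime with p ≥ 5, take coefficients a = 1, b = −2 (i.e., λ = p − 2), c = 0, so that φ(S) = (∑_{x∈S} x)² − 2·(∑_{x∈S} x²), and let k be the smallest integer greater than 2 dividing p − 1. Then 3 ≤ D(φ,p) ≤ (k−1)·(p−1)/k + 1. -/

import Mathlib

/-- `phi a b c S = a·(∑_{x∈S} x)² + b·(∑_{x∈S} x²) + c·(∑_{x∈S} x)`,
sums taken with multiplicity. -/
def phi {p : ℕ} (a b c : ZMod p) (S : Multiset (ZMod p)) : ZMod p :=
  a * S.sum ^ 2 + b * (S.map (fun x => x ^ 2)).sum + c * S.sum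

/-- `S` is φ-zero-free: no nonempty submultiset `T` of `S` has `phi a b c T = 0`. -/
def PhiZeroFree {p : ℕ} (a b c : ZMod p) (S : Multiset (ZMod p)) : Prop :=
  ∀ T : Multiset (ZMod p), T ≤ S → T ≠ 0 → phi a b c T ≠ 0

/-- The set of positive lengths `ℓ` such that every multiset over `ZMod p` of
cardinality at least `ℓ` has a nonempty submultiset `T` with `phi a b c T = 0`.
The Davenport φ-constant `D(φ,p)` is the least element of this set. -/
def DavSet {p : ℕ} (a b c : ZMod p) : Set ℕ :=
  {ℓ : ℕ | 0 < ℓ ∧ ∀ S : Multiset (ZMod p), ℓ ≤ Multiset.card S →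
    ∃ T : Multiset (ZMod p), T ≤ S ∧ T ≠ 0 ∧ phi a b c T = 0}

/-- If `k` divides `p - 1`, then `ZMod p` contains a primitive `k`-th root of unity. -/
theorem exists_isPrimitiveRoot_zmod {p k : ℕ} [Fact p.Prime] (hk : k ∣ p - 1) :
    ∃ ω : ZMod p, IsPrimitiveRoot ω k := by
  obtain ⟨g, hg⟩ := IsCyclic.exists_ofOrder_eq_natCard (α := (ZMod p)ˣ)
  rw [Nat.card_eq_fintype_card, ZMod.card_units] at hg
  obtain ⟨m, hm⟩ := hk
  have hp : 0 < p - 1 := Nat.sub_pos_of_lt (Fact.out : p.Prime).one_lt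
  have h : IsPrimitiveRoot g (p - 1) := hg ▸ IsPrimitiveRoot.orderOf g
  exact ⟨_, (IsPrimitiveRoot.coe_units_iff.mpr h).pow hp (hm.trans (mul_comm k m))⟩

/-- The form `(∑ x)² - 2 ∑ x²` vanishes on every dilate of the `k`-th roots of unity, `k > 2`. -/
theorem phi_dilate_roots_of_unity {p k : ℕ} [Fact p.Prime] (hk : 2 < k) {ω : ZMod p}
    (hω : IsPrimitiveRoot ω k) (c : ZMod p) :
    phi 1 (-2) 0 ((Multiset.range k).map fun i => c * ω ^ i) = 0 := by
  have h1 : ∑ i ∈ Finset.range k, ω ^ i = 0 := hω.geom_sum_eq_zero (by lia)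
  have h2 : ∑ i ∈ Finset.range k, (ω ^ 2) ^ i = 0 := by
    have h := geom_sum_mul (ω ^ 2) k
    rw [← pow_mul, mul_comm 2 k, pow_mul, hω.pow_eq_one, one_pow, sub_self] at h
    exact (mul_eq_zero.mp h).resolve_right
      (sub_ne_zero.mpr (hω.pow_ne_one_of_pos_of_lt two_ne_zero hk))
  have e1 : ((Multiset.range k).map fun i => c * ω ^ i).sum = 0 := by
    change ∑ i ∈ Finset.range k, c * ω ^ i = 0
    rw [← Finset.mul_sum, h1, mul_zero]
  have e2 : (((Multiset.range k).map fun i => c * ω ^ i).map fun x => x ^ 2).sum = 0 := by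
    rw [Multiset.map_map]
    change ∑ i ∈ Finset.range k, (c * ω ^ i) ^ 2 = 0
    simp_rw [mul_pow, ← pow_mul, mul_comm _ 2, pow_mul]
    rw [← Finset.mul_sum, h2, mul_zero]
  rw [phi, e1, e2]
  simp

/-- If fewer than `(p - 1) / k` nonzero elements are removed from `ZMod p`, some nonzero dilate of
the first `k` powers of a nonzero element `ω` survives. -/
theorem exists_dilate_powers_disjoint {p k m : ℕ} [Fact p.Prime] (hm : p - 1 = k * m)
    {ω : ZMod p} (hω : ω ≠ 0) (C : Finset (ZMod p)) (hC : C.card < m) :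
    ∃ c : ZMod p, c ≠ 0 ∧ ∀ i < k, c * ω ^ i ∉ C := by
  by_contra! h
  have hsub : Finset.univ.erase (0 : ZMod p) ⊆
      (Finset.range k ×ˢ C).image fun q => q.2 * (ω ^ q.1)⁻¹ := by
    intro c hc
    obtain ⟨i, hi, hiC⟩ := h c (Finset.ne_of_mem_erase hc)
    refine Finset.mem_image.mpr
      ⟨(i, c * ω ^ i), Finset.mk_mem_product (Finset.mem_range.mpr hi) hiC, ?_⟩
    exact mul_inv_cancel_right₀ (pow_ne_zero i hω) c
  have hcard := (Finset.card_le_card hsub).trans Finset.card_image_le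
  rw [Finset.card_erase_of_mem (Finset.mem_univ _), Finset.card_univ, ZMod.card,
    Finset.card_product, Finset.card_range, hm] at hcard
  have hp : 0 < k * m := hm ▸ Nat.sub_pos_of_lt (Fact.out : p.Prime).one_lt
  exact absurd (Nat.le_of_mul_le_mul_left hcard (Nat.pos_of_mul_pos_right hp)) (not_le.mpr hC)

theorem mem_davSet_of_dvd {p k : ℕ} [Fact p.Prime] (hk : 2 < k) (hkp : k ∣ p - 1) :
    (k - 1) * (p - 1) / k + 1 ∈ DavSet (1 : ZMod p) (-2) 0 := by
  refine ⟨Nat.succ_pos _, fun S hS => ?_⟩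
  by_cases h0 : (0 : ZMod p) ∈ S
  · exact ⟨{0}, Multiset.singleton_le.mpr h0, by simp, by simp [phi]⟩
  by_cases hnd : S.Nodup
  · obtain ⟨ω, hω⟩ := exists_isPrimitiveRoot_zmod hkp
    obtain ⟨m, hm⟩ := hkp
    have hω0 : ω ≠ 0 := hω.ne_zero (by lia)
    have hcard : ((Finset.univ.erase (0 : ZMod p)) \ S.toFinset).card < m := by
      rw [Finset.card_sdiff_of_subset, Multiset.toFinset_card_of_nodup hnd,
        Finset.card_erase_of_mem (Finset.mem_univ _), Finset.card_univ, ZMod.card]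
      · rw [hm, mul_left_comm, Nat.mul_div_cancel_left _ (by lia), Nat.sub_mul] at hS
        have : m ≤ k * m := Nat.le_mul_of_pos_left m (by lia)
        have : 0 < p - 1 := Nat.sub_pos_of_lt (Fact.out : p.Prime).one_lt
        have : 0 < m := Nat.pos_of_ne_zero (by rintro rfl; lia)
        lia
      · intro x hx
        refine Finset.mem_erase.mpr ⟨?_, Finset.mem_univ x⟩
        rintro rfl
        exact h0 (Multiset.mem_toFinset.mp hx)
    obtain ⟨c, hc, hcS⟩ := exists_dilate_powers_disjoint hm hω0 _ hcard
    refine ⟨(Multiset.range k).map fun i => c * ω ^ i, ?_, ?_, phi_dilate_roots_of_unity hk hω c⟩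
    · have hT : ((Multiset.range k).map fun i => c * ω ^ i).Nodup := by
        refine Multiset.Nodup.map_on ?_ (Multiset.nodup_range k)
        intro i hi j hj hij
        exact hω.pow_inj (Multiset.mem_range.mp hi) (Multiset.mem_range.mp hj)
          (mul_left_cancel₀ hc hij)
      rw [Multiset.le_iff_subset hT]
      intro x hx
      obtain ⟨i, hi, rfl⟩ := Multiset.mem_map.mp hx
      by_contra hxS
      exact hcS i (Multiset.mem_range.mp hi) (by simp [hc, hω0, hxS])
    · rw [← Multiset.card_pos, Multiset.card_map, Multiset.card_range]
      lia
  · simp only [Multiset.nodup_iff_le, not_forall, not_not] at hnd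
    obtain ⟨x, hx⟩ := hnd
    refine ⟨_, hx, by simp, ?_⟩
    simp [phi]
    ring

/-- The multiset `{1, 2}` is zero-free for the form `(∑ x)² - 2 ∑ x²`. -/
theorem phiZeroFree_one_two {p : ℕ} [Fact p.Prime] (hp : 2 < p) :
    PhiZeroFree (1 : ZMod p) (-2) 0 {1, 2} := by
  have h2 : (2 : ZMod p) ≠ 0 := by
    intro h
    have : p ∣ 2 := (ZMod.natCast_eq_zero_iff 2 p).mp (by exact_mod_cast h)
    exact absurd (Nat.le_of_dvd two_pos this) (by lia)
  intro T hT hT0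
  have hmem : T ∈ Multiset.powerset ({1, 2} : Multiset (ZMod p)) := Multiset.mem_powerset.mpr hT
  have hcases : T = {1, 2} ∨ T = {1} ∨ T = {2} ∨ T = 0 := by
    simpa [Multiset.insert_eq_cons, Multiset.powerset_cons, ← Multiset.cons_zero, or_assoc]
      using hmem
  rcases hcases with rfl | rfl | rfl | rfl
  · have : phi (1 : ZMod p) (-2) 0 {1, 2} = -1 := by simp [phi]; ring
    rw [this]
    exact neg_ne_zero.mpr one_ne_zero
  · have : phi (1 : ZMod p) (-2) 0 {1} = -1 := by simp [phi]; ring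
    rw [this]
    exact neg_ne_zero.mpr one_ne_zero
  · have : phi (1 : ZMod p) (-2) 0 {2} = -(2 ^ 2) := by simp [phi]; ring
    rw [this]
    exact neg_ne_zero.mpr (pow_ne_zero 2 h2)
  · exact absurd rfl hT0

/-- Theorem 3.1(a): for `p ≥ 5` and `φ(S) = (∑x)² - 2(∑x²)` (the case `λ = p - 2`),
with `k` the smallest integer greater than `2` dividing `p - 1`, we have
`3 ≤ D(φ,p) ≤ (k-1)(p-1)/k + 1`. -/
theorem davenport_phi_lambda_p_sub_two (p : ℕ) (hp : p.Prime) (hp5 : 5 ≤ p)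
    (k : ℕ) (hk : IsLeast {m : ℕ | 2 < m ∧ m ∣ p - 1} k) :
    ∃ D : ℕ, IsLeast (DavSet (1 : ZMod p) (-2) 0) D ∧
      3 ≤ D ∧ D ≤ (k - 1) * (p - 1) / k + 1 := by
  have : Fact p.Prime := ⟨hp⟩
  have hmem := mem_davSet_of_dvd hk.1.1 hk.1.2
  refine ⟨sInf (DavSet (1 : ZMod p) (-2) 0), ⟨Nat.sInf_mem ⟨_, hmem⟩, fun _ h => Nat.sInf_le h⟩,
    ?_, Nat.sInf_le hmem⟩
  by_contra! hlt
  obtain ⟨T, hT, hT0, hφ⟩ := (Nat.sInf_mem ⟨_, hmem⟩).2 {1, 2} (by simp; lia)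
  exact phiZeroFree_one_two (by lia) T hT hT0 hφ
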